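/- arXiv:math/0604061 — 2 statements merged into one kernel-verified Lean document; each statement's English description precedes it below -/
import Mathlib

section
/- Let G be a Garside group with Garside element Δ, set 𝒟 of simple elements, and N = ‖Δ‖. For every element g of G, the limit defining the translation number t_𝒟(g) exists and is a rational number of the form p/q for some integers p, q with 1 ≤ q ≤ N². -/
open Filter Topology Pointwise

/-- Left divisibility order on a group relative to a submonoid `P` of positive elements:
`a ≤_L b` iff `a⁻¹ * b ∈ P`. -/
def leL {G : Type*} [Group G] (P : Submonoid G) (a b : G) : Prop := a⁻¹ * b ∈ P

/-- Right divisibility order: `a ≤_R b` iff `b * a⁻¹ ∈ P`. -/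
def leR {G : Type*} [Group G] (P : Submonoid G) (a b : G) : Prop := b * a⁻¹ ∈ P

/-- An atom of the positive monoid `P`: a nontrivial element admitting no nontrivial
factorization inside `P`. -/
def IsMonAtom {G : Type*} [Group G] (P : Submonoid G) (a : G) : Prop :=
  a ∈ P ∧ a ≠ 1 ∧ ∀ b c : G, b ∈ P → c ∈ P → a = b * c → b = 1 ∨ c = 1

/-- `a` can be written as a product of `n` atoms of `P`. -/
def IsAtomProd {G : Type*} [Group G] (P : Submonoid G) (n : ℕ) (a : G) : Prop :=
  ∃ l : List G, l.length = n ∧ (∀ x ∈ l, IsMonAtom P x) ∧ l.prod = a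

/-- A Garside structure on a group `G`: `G` is the group of fractions of the positive
monoid `P`, which is a finitely generated atomic monoid (with atomic norm `norm`),
a lattice for both `≤_L` and `≤_R`, equipped with a Garside element `Δ` whose left and
right divisors coincide and generate `P`.  The fields `zinf`, `zsup`, `infs`, `sups`,
`tinf`, `tsup` are the (uniquely determined) invariants
`inf g = max {r : Δ^r ≤_L g}`, `sup g = min {s : g ≤_L Δ^s}`,
`inf_s g = max {inf h : h ∈ [g]}`, `sup_s g = min {sup h : h ∈ [g]}`,
`t_inf g = lim inf(gⁿ)/n` and `t_sup g = lim sup(gⁿ)/n`,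
each given together with its defining specification. -/
structure GarsideGroup (G : Type*) [Group G] where
  P : Submonoid G
  /-- `G` is the group of fractions of `P`. -/
  fraction : ∀ g : G, ∃ a b : G, a ∈ P ∧ b ∈ P ∧ g = a⁻¹ * b
  /-- `P` is finitely generated. -/
  fg : P.FG
  /-- the atomic norm `‖·‖` -/
  norm : G → ℕ
  /-- `P` is atomic: every positive element is a product of atoms and `norm a` is the
  greatest length of such an expression. -/
  norm_spec : ∀ a ∈ P, IsGreatest {n : ℕ | IsAtomProd P n a} (norm a)
  /-- `(P, ≤_L)` is a lattice: gcd's and lcm's exist. -/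
  latticeL : ∀ a ∈ P, ∀ b ∈ P,
    (∃ c ∈ P, leL P c a ∧ leL P c b ∧ ∀ d ∈ P, leL P d a → leL P d b → leL P d c) ∧
    (∃ c ∈ P, leL P a c ∧ leL P b c ∧ ∀ d ∈ P, leL P a d → leL P b d → leL P c d)
  /-- `(P, ≤_R)` is a lattice. -/
  latticeR : ∀ a ∈ P, ∀ b ∈ P,
    (∃ c ∈ P, leR P c a ∧ leR P c b ∧ ∀ d ∈ P, leR P d a → leR P d b → leR P d c) ∧
    (∃ c ∈ P, leR P a c ∧ leR P b c ∧ ∀ d ∈ P, leR P a d → leR P b d → leR P c d)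
  /-- the Garside element -/
  Δ : G
  Δ_mem : Δ ∈ P
  /-- the left and right divisors of `Δ` coincide -/
  Δ_balanced : ∀ a ∈ P, (leL P a Δ ↔ leR P a Δ)
  /-- the simple elements generate `P` -/
  simples_gen : Submonoid.closure {a : G | a ∈ P ∧ leL P a Δ} = P
  /-- `inf g = max {r : ℤ | Δ^r ≤_L g}` -/
  zinf : G → ℤ
  /-- `sup g = min {s : ℤ | g ≤_L Δ^s}` -/
  zsup : G → ℤ
  zinf_spec : ∀ g : G, IsGreatest {r : ℤ | leL P (Δ ^ r) g} (zinf g)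
  zsup_spec : ∀ g : G, IsLeast {s : ℤ | leL P g (Δ ^ s)} (zsup g)
  /-- `inf_s g = max {inf h : h ∈ [g]}` -/
  infs : G → ℤ
  /-- `sup_s g = min {sup h : h ∈ [g]}` -/
  sups : G → ℤ
  infs_spec : ∀ g : G, IsGreatest (Set.range fun h : G => zinf (h⁻¹ * g * h)) (infs g)
  sups_spec : ∀ g : G, IsLeast (Set.range fun h : G => zsup (h⁻¹ * g * h)) (sups g)
  /-- `t_inf g = lim_{n → ∞} inf(gⁿ)/n` -/
  tinf : G → ℝ
  /-- `t_sup g = lim_{n → ∞} sup(gⁿ)/n` -/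
  tsup : G → ℝ
  tinf_spec : ∀ g : G,
    Filter.Tendsto (fun n : ℕ => (zinf (g ^ n) : ℝ) / (n : ℝ)) Filter.atTop (nhds (tinf g))
  tsup_spec : ∀ g : G,
    Filter.Tendsto (fun n : ℕ => (zsup (g ^ n) : ℝ) / (n : ℝ)) Filter.atTop (nhds (tsup g))

namespace GarsideGroup

variable {G : Type*} [Group G] (Γ : GarsideGroup G)

/-- The set `𝒟` of simple elements. -/
def simples : Set G := {a : G | a ∈ Γ.P ∧ leL Γ.P a Γ.Δ}

/-- `len g = sup g - inf g` -/
def len (g : G) : ℤ := Γ.zsup g - Γ.zinf g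

/-- `t_len g = t_sup g - t_inf g` -/
noncomputable def tlen (g : G) : ℝ := Γ.tsup g - Γ.tinf g

/-- `g` is inf-straight if `inf g = t_inf g`. -/
def InfStraight (g : G) : Prop := (Γ.zinf g : ℝ) = Γ.tinf g

/-- `g` is sup-straight if `sup g = t_sup g`. -/
def SupStraight (g : G) : Prop := (Γ.zsup g : ℝ) = Γ.tsup g

/-- The super summit set `[g]^S`. -/
def superSummit (g : G) : Set G :=
  {h : G | (∃ x : G, x⁻¹ * g * x = h) ∧ Γ.zinf h = Γ.infs g ∧ Γ.zsup h = Γ.sups g}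

end GarsideGroup

/-- The shortest length of a word over the alphabet `X` representing `g`. -/
noncomputable def wlen {G : Type*} [Group G] (X : Set G) (g : G) : ℕ :=
  sInf {n : ℕ | ∃ l : List G, l.length = n ∧ (∀ x ∈ l, x ∈ X) ∧ l.prod = g}

namespace GarsideGroup

section basics

variable {G : Type*} [Group G] (Γ : GarsideGroup G)

theorem leL_refl' (a : G) : leL Γ.P a a := by
  simp [leL, Γ.P.one_mem]

theorem leL_trans' {a b c : G} (h1 : leL Γ.P a b) (h2 : leL Γ.P b c) : leL Γ.P a c := by
  have := Γ.P.mul_mem h1 h2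
  simpa [leL, mul_assoc] using this

theorem leL_mul_left {a b : G} (c : G) (h : leL Γ.P a b) : leL Γ.P (c * a) (c * b) := by
  simpa [leL, mul_assoc] using h

theorem norm_add_le {a b : G} (ha : a ∈ Γ.P) (hb : b ∈ Γ.P) :
    Γ.norm a + Γ.norm b ≤ Γ.norm (a * b) := by
  obtain ⟨l1, h1, h1', h1''⟩ := (Γ.norm_spec a ha).1
  obtain ⟨l2, h2, h2', h2''⟩ := (Γ.norm_spec b hb).1
  refine (Γ.norm_spec (a * b) (Γ.P.mul_mem ha hb)).2 ⟨l1 ++ l2, ?_, ?_, ?_⟩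
  · simp [h1, h2]
  · intro x hx
    rcases List.mem_append.1 hx with hx | hx
    · exact h1' x hx
    · exact h2' x hx
  · simp [h1'', h2'']

theorem eq_one_of_norm {a : G} (ha : a ∈ Γ.P) (h : Γ.norm a = 0) : a = 1 := by
  obtain ⟨l, h1, h2, h3⟩ := (Γ.norm_spec a ha).1
  rw [h] at h1
  rw [List.length_eq_zero_iff] at h1
  subst h1
  simpa using h3.symm

theorem norm_one' : Γ.norm 1 = 0 := by
  have := Γ.norm_add_le Γ.P.one_mem Γ.P.one_mem
  simp only [mul_one] at this
  omega

theorem leL_antisymm' {a b : G} (h1 : leL Γ.P a b) (h2 : leL Γ.P b a) : a = b := by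
  have h := Γ.norm_add_le h1 h2
  have e : a⁻¹ * b * (b⁻¹ * a) = 1 := by group
  rw [e, Γ.norm_one'] at h
  have := Γ.eq_one_of_norm h1 (by omega)
  exact (inv_mul_eq_one.1 this)

theorem Δ_ne_one : Γ.Δ ≠ 1 := by
  intro h
  obtain ⟨h1, h2⟩ := Γ.zinf_spec 1
  have : Γ.zinf 1 + 1 ∈ {r : ℤ | leL Γ.P (Γ.Δ ^ r) 1} := by
    simp [h, leL, Γ.P.one_mem]
  have := h2 this
  omega

theorem norm_Δ_pos : 1 ≤ Γ.norm Γ.Δ := by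
  by_contra h
  exact Γ.Δ_ne_one (Γ.eq_one_of_norm Γ.Δ_mem (by omega))

theorem conj1 {x : G} (hx : x ∈ Γ.P) : Γ.Δ⁻¹ * x * Γ.Δ ∈ Γ.P := by
  rw [← Γ.simples_gen] at hx
  induction hx using Submonoid.closure_induction with
  | mem s hs =>
    obtain ⟨hs, hs'⟩ := hs
    have ht : leL Γ.P (s⁻¹ * Γ.Δ) Γ.Δ := by
      rw [Γ.Δ_balanced _ hs']
      simpa [leR] using hs
    simpa [leL, mul_assoc] using ht
  | one => simp [Γ.P.one_mem]
  | mul a b _ _ ha hb =>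
    have := Γ.P.mul_mem ha hb
    simpa [mul_assoc] using this

theorem conj2 {x : G} (hx : x ∈ Γ.P) : Γ.Δ * x * Γ.Δ⁻¹ ∈ Γ.P := by
  rw [← Γ.simples_gen] at hx
  induction hx using Submonoid.closure_induction with
  | mem s hs =>
    obtain ⟨hs, hs'⟩ := hs
    have hs'' := (Γ.Δ_balanced s hs).1 hs'
    have ht : leR Γ.P (Γ.Δ * s⁻¹) Γ.Δ := by
      rw [← Γ.Δ_balanced _ hs'']
      simpa [leL, mul_assoc] using hs
    simpa [leR, mul_assoc] using ht
  | one => simp [Γ.P.one_mem]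
  | mul a b _ _ ha hb =>
    have := Γ.P.mul_mem ha hb
    simpa [mul_assoc] using this

theorem conjz {x : G} (hx : x ∈ Γ.P) (z : ℤ) : Γ.Δ ^ (-z) * x * Γ.Δ ^ z ∈ Γ.P := by
  induction z with
  | zero => simpa using hx
  | succ n ih =>
    have := Γ.conj1 ih
    have e : Γ.Δ ^ (-((n : ℤ) + 1)) * x * Γ.Δ ^ ((n : ℤ) + 1)
        = Γ.Δ⁻¹ * (Γ.Δ ^ (-(n : ℤ)) * x * Γ.Δ ^ (n : ℤ)) * Γ.Δ := by group
    rw [e]; exact this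
  | pred n ih =>
    have := Γ.conj2 ih
    have e : Γ.Δ ^ (-(-(n : ℤ) - 1)) * x * Γ.Δ ^ (-(n : ℤ) - 1)
        = Γ.Δ * (Γ.Δ ^ (-(-(n : ℤ))) * x * Γ.Δ ^ (-(n : ℤ))) * Γ.Δ⁻¹ := by group
    rw [e]; exact this

theorem leL_mul_right {a b : G} (z : ℤ) (h : leL Γ.P a b) :
    leL Γ.P (a * Γ.Δ ^ z) (b * Γ.Δ ^ z) := by
  have := Γ.conjz h z
  have e : (a * Γ.Δ ^ z)⁻¹ * (b * Γ.Δ ^ z) = Γ.Δ ^ (-z) * (a⁻¹ * b) * Γ.Δ ^ z := by group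
  unfold leL
  rw [e]; exact this

theorem zpow_mem {n : ℤ} (hn : 0 ≤ n) : Γ.Δ ^ n ∈ Γ.P := by
  lift n to ℕ using hn
  rw [zpow_natCast]
  exact Γ.P.pow_mem Γ.Δ_mem n

theorem le_mul_zpow (a : G) {n : ℤ} (hn : 0 ≤ n) : leL Γ.P a (a * Γ.Δ ^ n) := by
  simpa [leL] using Γ.zpow_mem hn

theorem zpow_le_zpow {m n : ℤ} (hn : m ≤ n) : leL Γ.P (Γ.Δ ^ m) (Γ.Δ ^ n) := by
  have e : (Γ.Δ ^ m)⁻¹ * Γ.Δ ^ n = Γ.Δ ^ (n - m) := by group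
  unfold leL
  rw [e]; exact Γ.zpow_mem (by omega)

theorem le_zinf_iff (g : G) (r : ℤ) : r ≤ Γ.zinf g ↔ leL Γ.P (Γ.Δ ^ r) g :=
  ⟨fun h => Γ.leL_trans' (Γ.zpow_le_zpow h) (Γ.zinf_spec g).1, fun h => (Γ.zinf_spec g).2 h⟩

theorem zsup_le_iff (g : G) (r : ℤ) : Γ.zsup g ≤ r ↔ leL Γ.P g (Γ.Δ ^ r) :=
  ⟨fun h => Γ.leL_trans' (Γ.zsup_spec g).1 (Γ.zpow_le_zpow h), fun h => (Γ.zsup_spec g).2 h⟩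

theorem zpow_le_mul {a b : G} {m n : ℤ} (ha : leL Γ.P (Γ.Δ ^ m) a) (hb : leL Γ.P (Γ.Δ ^ n) b) :
    leL Γ.P (Γ.Δ ^ (m + n)) (a * b) := by
  rw [zpow_add]
  exact Γ.leL_trans' (Γ.leL_mul_right n ha) (Γ.leL_mul_left a hb)

theorem mul_le_zpow {a b : G} {m n : ℤ} (ha : leL Γ.P a (Γ.Δ ^ m)) (hb : leL Γ.P b (Γ.Δ ^ n)) :
    leL Γ.P (a * b) (Γ.Δ ^ (m + n)) := by
  rw [zpow_add]
  exact Γ.leL_trans' (Γ.leL_mul_left a hb) (Γ.leL_mul_right n ha)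

theorem zinf_mul (a b : G) : Γ.zinf a + Γ.zinf b ≤ Γ.zinf (a * b) := by
  rw [le_zinf_iff]
  exact Γ.zpow_le_mul (Γ.zinf_spec a).1 (Γ.zinf_spec b).1

theorem le_zpow_inv (g : G) (s : ℤ) : leL Γ.P g (Γ.Δ ^ s) ↔ leL Γ.P (Γ.Δ ^ (-s)) g⁻¹ := by
  constructor
  · intro h
    have := Γ.leL_mul_right (-s) (Γ.leL_mul_left g⁻¹ h)
    simpa using this
  · intro h
    have := Γ.leL_mul_right s (Γ.leL_mul_left g h)
    simpa using this

theorem zsup_eq (g : G) : Γ.zsup g = - Γ.zinf g⁻¹ := by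
  apply le_antisymm
  · rw [zsup_le_iff, le_zpow_inv, neg_neg, ← le_zinf_iff]
  · have := (Γ.zsup_le_iff g _).1 le_rfl
    rw [le_zpow_inv, ← le_zinf_iff] at this
    omega

theorem exists_meet (a b : G) : ∃ m : G, leL Γ.P m a ∧ leL Γ.P m b ∧
    ∀ e, leL Γ.P e a → leL Γ.P e b → leL Γ.P e m := by
  -- push into `P`
  set z : ℤ := min (Γ.zinf a) (Γ.zinf b) with hz
  have ha : Γ.Δ ^ (-z) * a ∈ Γ.P := by
    have := (Γ.le_zinf_iff a z).1 (min_le_left _ _)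
    simpa [leL] using this
  have hb : Γ.Δ ^ (-z) * b ∈ Γ.P := by
    have := (Γ.le_zinf_iff b z).1 (min_le_right _ _)
    simpa [leL] using this
  obtain ⟨d, hd, hda, hdb, hdm⟩ := (Γ.latticeL _ ha _ hb).1
  refine ⟨Γ.Δ ^ z * d, ?_, ?_, ?_⟩
  · simpa using Γ.leL_mul_left (Γ.Δ ^ z) hda
  · simpa using Γ.leL_mul_left (Γ.Δ ^ z) hdb
  · intro e hea heb
    obtain ⟨u, v, hu, hv, huv⟩ := Γ.fraction (Γ.Δ ^ (-z) * e)
    have hea' := Γ.leL_mul_left (u * Γ.Δ ^ (-z)) hea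
    have heb' := Γ.leL_mul_left (u * Γ.Δ ^ (-z)) heb
    have hv' : u * Γ.Δ ^ (-z) * e = v := by rw [mul_assoc, huv]; group
    rw [hv', mul_assoc] at hea' heb'
    obtain ⟨w, hw, hwa, hwb, hwm⟩ := (Γ.latticeL _ (Γ.P.mul_mem hu ha) _ (Γ.P.mul_mem hu hb)).1
    have huw : leL Γ.P u w := hwm u hu (by simpa [leL] using ha) (by simpa [leL] using hb)
    have h1 : leL Γ.P (u⁻¹ * w) d := by
      apply hdm _ huw
      · simpa using Γ.leL_mul_left u⁻¹ hwa
      · simpa using Γ.leL_mul_left u⁻¹ hwb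
    have h2 : leL Γ.P v w := hwm v hv hea' heb'
    have h3 : leL Γ.P (u⁻¹ * v) d := Γ.leL_trans' (Γ.leL_mul_left u⁻¹ h2) h1
    rw [← huv] at h3
    simpa using Γ.leL_mul_left (Γ.Δ ^ z) h3

end basics

section words

variable {G : Type*} [Group G] (Γ : GarsideGroup G)

theorem simples_word (b : ℕ) (p : G) (hp : p ∈ Γ.P) (h : leL Γ.P p (Γ.Δ ^ (b : ℤ))) :
    ∃ l : List G, l.length = b ∧ (∀ x ∈ l, x ∈ Γ.simples) ∧ l.prod = p := by
  induction b generalizing p with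
  | zero =>
    refine ⟨[], rfl, by simp, ?_⟩
    have h1 : leL Γ.P 1 p := by simpa [leL] using hp
    simpa using Γ.leL_antisymm' h1 (by simpa using h)
  | succ b ih =>
    obtain ⟨d, hd1, hd2, hd3⟩ := Γ.exists_meet p Γ.Δ
    have hd : leL Γ.P 1 d := hd3 1 (by simpa [leL] using hp) (by simpa [leL] using Γ.Δ_mem)
    have hd' : d ∈ Γ.P := by simpa [leL] using hd
    have key : leL Γ.P (p * Γ.Δ ^ (-(b : ℤ))) d := by
      apply hd3
      · have := Γ.leL_mul_right (-(b : ℤ)) (Γ.le_mul_zpow p (n := b) (by omega))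
        simpa using this
      · have := Γ.leL_mul_right (-(b : ℤ)) h
        have e : Γ.Δ ^ (((b + 1 : ℕ)) : ℤ) * Γ.Δ ^ (-(b : ℤ)) = Γ.Δ := by
          rw [← zpow_add]; simp
        rwa [e] at this
    have key2 : leL Γ.P (d⁻¹ * p) (Γ.Δ ^ (b : ℤ)) := by
      have := Γ.leL_mul_left d⁻¹ (Γ.leL_mul_right (b : ℤ) key)
      simpa using this
    obtain ⟨l, h1, h2, h3⟩ := ih (d⁻¹ * p) hd1 key2
    refine ⟨d :: l, by simp [h1], ?_, by simp [h3]⟩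
    intro x hx
    rcases List.mem_cons.1 hx with rfl | hx
    · exact ⟨hd', hd2⟩
    · exact h2 x hx

theorem word_upper (a b : ℕ) (g : G) (ha : leL Γ.P (Γ.Δ ^ (-(a : ℤ))) g)
    (hb : leL Γ.P g (Γ.Δ ^ (b : ℤ))) :
    ∃ l : List G, l.length = a + b ∧ (∀ x ∈ l, x ∈ Γ.simples ∪ Γ.simples⁻¹) ∧ l.prod = g := by
  obtain ⟨m, hm1, hm2, hm3⟩ := Γ.exists_meet g 1
  have k1 : leL Γ.P (Γ.Δ ^ (-(a : ℤ))) m := by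
    apply hm3 _ ha
    simpa using Γ.zpow_le_zpow (m := -(a : ℤ)) (n := 0) (by omega)
  have k2 : leL Γ.P (g * Γ.Δ ^ (-(b : ℤ))) m := by
    apply hm3
    · have := Γ.leL_mul_right (-(b : ℤ)) (Γ.le_mul_zpow g (n := b) (by omega))
      simpa using this
    · have := Γ.leL_mul_right (-(b : ℤ)) hb
      simpa using this
  have k3 : leL Γ.P (m⁻¹ * g) (Γ.Δ ^ (b : ℤ)) := by
    have := Γ.leL_mul_left m⁻¹ (Γ.leL_mul_right (b : ℤ) k2)
    simpa using this
  have k4 : leL Γ.P m⁻¹ (Γ.Δ ^ (a : ℤ)) := by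
    rw [le_zpow_inv, inv_inv]; exact k1
  have k5 : m⁻¹ ∈ Γ.P := by simpa [leL] using hm2
  obtain ⟨l1, h1, h1', h1''⟩ := Γ.simples_word a _ k5 k4
  obtain ⟨l2, h2, h2', h2''⟩ := Γ.simples_word b _ hm1 k3
  refine ⟨(l1.map (·⁻¹)).reverse ++ l2, by simp [h1, h2], ?_, ?_⟩
  · intro x hx
    rcases List.mem_append.1 hx with hx | hx
    · right
      rw [List.mem_reverse, List.mem_map] at hx
      obtain ⟨y, hy, rfl⟩ := hx
      simpa using h1' y hy
    · left; exact h2' x hx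
  · rw [List.prod_append, ← List.prod_inv_reverse, h1'', h2'']
    group

theorem word_lower (l : List G) (hl : ∀ x ∈ l, x ∈ Γ.simples ∪ Γ.simples⁻¹) :
    ∃ a b : ℕ, a + b = l.length ∧ leL Γ.P (Γ.Δ ^ (-(a : ℤ))) l.prod ∧
      leL Γ.P l.prod (Γ.Δ ^ (b : ℤ)) := by
  induction l with
  | nil => exact ⟨0, 0, by simp [leL, Γ.P.one_mem]⟩
  | cons x l ih =>
    obtain ⟨a, b, hab, h1, h2⟩ := ih (fun y hy => hl y (List.mem_cons_of_mem _ hy))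
    rw [List.prod_cons]
    rcases hl x List.mem_cons_self with hx | hx
    · obtain ⟨hx1, hx2⟩ := hx
      refine ⟨a, b + 1, by simp; omega, ?_, ?_⟩
      · have := Γ.zpow_le_mul (a := x) (m := 0) (by simpa [leL] using hx1) h1
        simpa using this
      · have := Γ.mul_le_zpow (a := x) (m := 1) (by simpa using hx2) h2
        rw [add_comm] at this
        exact_mod_cast this
    · obtain ⟨hx1, hx2⟩ := (Set.mem_inv.1 hx : x⁻¹ ∈ Γ.simples)
      refine ⟨a + 1, b, by simp; omega, ?_, ?_⟩
      · have hx3 : leL Γ.P (Γ.Δ ^ (-(1 : ℤ))) x := by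
          have := (Γ.le_zpow_inv x⁻¹ 1).1 (by simpa using hx2)
          simpa using this
        have := Γ.zpow_le_mul hx3 h1
        have e : (-((a + 1 : ℕ) : ℤ)) = -1 + -(a : ℤ) := by push_cast; ring
        rw [e]; exact this
      · have := Γ.mul_le_zpow (a := x) (m := 0) (by simpa [leL] using hx1) h2
        simpa using this

theorem wlen_eq (g : G) : (wlen (Γ.simples ∪ Γ.simples⁻¹) g : ℤ)
    = max (Γ.zsup g) 0 + max (-Γ.zinf g) 0 := by
  have hup : (max (-Γ.zinf g) 0).toNat + (max (Γ.zsup g) 0).toNat ∈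
      {n : ℕ | ∃ l : List G, l.length = n ∧ (∀ x ∈ l, x ∈ Γ.simples ∪ Γ.simples⁻¹) ∧
        l.prod = g} := by
    apply Γ.word_upper
    · rw [← le_zinf_iff]; omega
    · rw [← zsup_le_iff]; omega
  have h1 := Nat.sInf_le hup
  obtain ⟨l, hl1, hl2, hl3⟩ := Nat.sInf_mem (Set.nonempty_of_mem hup)
  obtain ⟨a, b, hab, ha, hb⟩ := Γ.word_lower l hl2
  rw [hl3] at ha hb
  rw [← le_zinf_iff] at ha
  rw [← zsup_le_iff] at hb
  change wlen (Γ.simples ∪ Γ.simples⁻¹) g ≤ _ at h1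
  change _ = wlen (Γ.simples ∪ Γ.simples⁻¹) g at hl1
  omega

end words

section trans

variable {G : Type*} [Group G] (Γ : GarsideGroup G)

theorem tinf_pow (g : G) (k : ℕ) (hk : 1 ≤ k) : Γ.tinf (g ^ k) = k * Γ.tinf g := by
  have h1 := Γ.tinf_spec (g ^ k)
  have h2 := (Γ.tinf_spec g).comp
    (tendsto_atTop_mono (fun n : ℕ => (show n ≤ k * n by nlinarith)) tendsto_id)
  have h3 := h2.const_mul (k : ℝ)
  refine tendsto_nhds_unique h1 (h3.congr fun n => ?_)
  have : (k : ℝ) ≠ 0 := by positivity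
  simp only [Function.comp, pow_mul]
  push_cast
  rcases Nat.eq_zero_or_pos n with rfl | hn
  · simp
  · field_simp

theorem tsup_eq (g : G) : Γ.tsup g = - Γ.tinf g⁻¹ := by
  refine tendsto_nhds_unique (Γ.tsup_spec g) ((Γ.tinf_spec g⁻¹).neg.congr fun n => ?_)
  rw [zsup_eq, inv_pow]
  push_cast
  ring

/-- If `Δ ^ (n * s) ≤ h⁻¹ g ^ (n * k) h` for all `n`, then `s / k ≤ t_inf g`. -/
theorem tinf_ge (g h : G) (k : ℕ) (hk : 1 ≤ k) (s : ℤ)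
    (H : ∀ n : ℕ, leL Γ.P (Γ.Δ ^ (n * s)) (h⁻¹ * (g ^ k) ^ n * h)) : (s : ℝ) ≤ k * Γ.tinf g := by
  rw [← Γ.tinf_pow g k hk]
  set C : ℤ := Γ.zinf h + Γ.zinf h⁻¹
  have h1 : ∀ n : ℕ, n * s + C ≤ Γ.zinf ((g ^ k) ^ n) := by
    intro n
    have a1 := (Γ.le_zinf_iff _ _).2 (H n)
    have a2 := Γ.zinf_mul h (h⁻¹ * (g ^ k) ^ n * h)
    have a3 := Γ.zinf_mul (h * (h⁻¹ * (g ^ k) ^ n * h)) h⁻¹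
    have e : h * (h⁻¹ * (g ^ k) ^ n * h) * h⁻¹ = (g ^ k) ^ n := by
      simp [mul_assoc]
    rw [e] at a3
    omega
  have h2 : Tendsto (fun n : ℕ => (s : ℝ) + (C : ℝ) / (n : ℝ)) atTop (𝓝 ((s : ℝ) + 0)) :=
    tendsto_const_nhds.add (tendsto_const_div_atTop_nhds_zero_nat _)
  rw [add_zero] at h2
  refine le_of_tendsto_of_tendsto h2 (Γ.tinf_spec (g ^ k)) ?_
  filter_upwards [eventually_ge_atTop 1] with n hn
  have hn' : (0 : ℝ) < n := by exact_mod_cast hn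
  rw [le_div_iff₀ hn', add_mul, div_mul_cancel₀ _ hn'.ne']
  have := h1 n
  have : ((n * s + C : ℤ) : ℝ) ≤ (Γ.zinf ((g ^ k) ^ n) : ℝ) := by exact_mod_cast this
  push_cast at this
  linarith

theorem exists_large (g h : G) (r : ℤ) (hr : (r : ℝ) < Γ.tinf g) (C : ℤ) :
    ∃ n : ℕ, 1 ≤ n ∧ n * r + C ≤ Γ.zinf (g ^ n) := by
  obtain ⟨s, hs1, hs2⟩ := exists_between hr
  have h1 := (Γ.tinf_spec g).eventually (lt_mem_nhds hs2)
  obtain ⟨n0, hn0⟩ := exists_nat_gt ((C : ℝ) / (s - r))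
  obtain ⟨n, hn1, hn2, hn3⟩ := (h1.and ((eventually_ge_atTop 1).and (eventually_ge_atTop n0))).exists
  refine ⟨n, hn2, ?_⟩
  have hn' : (0 : ℝ) < n := by exact_mod_cast hn2
  rw [lt_div_iff₀ hn'] at hn1
  have hsr : 0 < s - r := by linarith
  rw [div_lt_iff₀ hsr] at hn0
  have hnn : (n0 : ℝ) ≤ n := by exact_mod_cast hn3
  have : ((n * r + C : ℤ) : ℝ) ≤ (Γ.zinf (g ^ n) : ℝ) := by
    push_cast
    nlinarith
  exact_mod_cast this

/-- The lattice automorphism `x ↦ g ^ n x Δ ^ (- n r)`. -/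
def act (g : G) (r n : ℤ) (x : G) : G := g ^ n * x * Γ.Δ ^ (-(n * r))

theorem act_mono (g : G) (r n : ℤ) {x y : G} (h : leL Γ.P x y) :
    leL Γ.P (Γ.act g r n x) (Γ.act g r n y) :=
  Γ.leL_mul_right _ (Γ.leL_mul_left _ h)

theorem act_act (g : G) (r m n : ℤ) (x : G) :
    Γ.act g r m (Γ.act g r n x) = Γ.act g r (m + n) x := by
  unfold act
  have : -((m + n) * r) = -(n * r) + -(m * r) := by ring
  rw [this, zpow_add, zpow_add]
  simp [mul_assoc]

theorem act_zero (g : G) (r : ℤ) (x : G) : Γ.act g r 0 x = x := by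
  simp [act]

theorem act_Δ (g : G) (r n z : ℤ) (x : G) :
    Γ.act g r n (x * Γ.Δ ^ z) = Γ.act g r n x * Γ.Δ ^ z := by
  unfold act
  rw [mul_assoc, mul_assoc, mul_assoc, mul_assoc, ← zpow_add, ← zpow_add, add_comm]

theorem exists_finite_meet (u : ℕ → G) (n : ℕ) : ∃ k, (∀ i ≤ n, leL Γ.P k (u i)) ∧
    ∀ e, (∀ i ≤ n, leL Γ.P e (u i)) → leL Γ.P e k := by
  induction n with
  | zero =>
    refine ⟨u 0, ?_, fun e he => he 0 le_rfl⟩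
    intro i hi
    obtain rfl : i = 0 := by omega
    exact Γ.leL_refl' _
  | succ n ih =>
    obtain ⟨k, hk1, hk2⟩ := ih
    obtain ⟨m, hm1, hm2, hm3⟩ := Γ.exists_meet k (u (n + 1))
    refine ⟨m, ?_, ?_⟩
    · intro i hi
      rcases Nat.lt_or_ge n i with h | h
      · obtain rfl : i = n + 1 := by omega
        exact hm2
      · exact Γ.leL_trans' hm1 (hk1 i h)
    · intro e he
      exact hm3 e (hk2 e fun i hi => he i (by omega)) (he _ le_rfl)

theorem exists_sub (g : G) (r : ℤ) (hr : (r : ℝ) < Γ.tinf g) :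
    ∃ h, leL Γ.P h (Γ.act g r 1 h) := by
  obtain ⟨n, hn, hn'⟩ := Γ.exists_large g 1 r hr 0
  have h1 : leL Γ.P 1 (Γ.act g r n 1) := by
    rw [le_zinf_iff] at hn'
    have := Γ.leL_mul_right (-(n * r)) hn'
    simpa [act] using this
  obtain ⟨k, hk1, hk2⟩ := Γ.exists_finite_meet (fun i => Γ.act g r i 1) (n - 1)
  refine ⟨k, ?_⟩
  have h2 : leL Γ.P (Γ.act g r (-1) k) k := by
    apply hk2
    intro i hi
    have h3 : leL Γ.P k (Γ.act g r ((i : ℤ) + 1) 1) := by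
      rcases Nat.lt_or_ge (i + 1) n with h | h
      · have := hk1 (i + 1) (by omega)
        simpa using this
      · have e : ((i : ℤ) + 1) = n := by omega
        rw [e]
        have h0 := hk1 0 (by omega)
        simp only [Nat.cast_zero, act_zero] at h0
        exact Γ.leL_trans' h0 h1
    have h4 := Γ.act_mono g r (-1) h3
    rw [act_act] at h4
    have e : -1 + ((i : ℤ) + 1) = i := by ring
    rwa [e] at h4
  have h5 := Γ.act_mono g r 1 h2
  rw [act_act] at h5
  simpa [act_zero] using h5

theorem gap (g : G) (r : ℤ) (hr : (r : ℝ) < Γ.tinf g) :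
    (r : ℝ) + 1 / (Γ.norm Γ.Δ : ℝ) ≤ Γ.tinf g := by
  obtain ⟨h, hh⟩ := Γ.exists_sub g r hr
  have hx := fun n : ℕ => Γ.exists_meet (Γ.act g r n h) (h * Γ.Δ ^ (1 : ℤ))
  choose x x1 x2 x3 using hx
  have stepn : ∀ n : ℤ, leL Γ.P (Γ.act g r n h) (Γ.act g r (n + 1) h) := by
    intro n
    have := Γ.act_mono g r n hh
    rwa [act_act] at this
  have xmono : ∀ n, leL Γ.P (x n) (x (n + 1)) := by
    intro n
    apply x3 _ _ _ (x2 n)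
    have := Γ.leL_trans' (x1 n) (stepn n)
    simpa using this
  have hx0 : leL Γ.P h (x 0) := by
    apply x3
    · simpa [act_zero] using Γ.leL_refl' h
    · exact Γ.le_mul_zpow _ (by norm_num)
  have hxn : ∀ n, leL Γ.P h (x n) := by
    intro n
    induction n with
    | zero => exact hx0
    | succ n ih => exact Γ.leL_trans' ih (xmono n)
  have stab1 : ∀ n, x n = x (n + 1) → x (n + 1) = x (n + 2) := by
    intro n hn
    apply Γ.leL_antisymm' (xmono _)
    have a1 : leL Γ.P (Γ.act g r (-1) (x (n + 2))) (x (n + 1)) := by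
      apply x3
      · have := Γ.act_mono g r (-1) (x1 (n + 2))
        rw [act_act] at this
        have e : -1 + ((n + 2 : ℕ) : ℤ) = ((n + 1 : ℕ) : ℤ) := by push_cast; ring
        rwa [e] at this
      · have b1 := Γ.leL_trans' (x2 (n + 2)) (Γ.leL_mul_right 1 hh)
        have := Γ.act_mono g r (-1) b1
        rw [act_Δ, act_act] at this
        simpa [act_zero] using this
    rw [← hn] at a1
    have a2 := Γ.act_mono g r 1 a1
    rw [act_act] at a2
    have a3 := Γ.act_mono g r 1 (x1 n)
    rw [act_act] at a3
    have a4 := Γ.leL_trans' a2 a3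
    apply x3 _ _ _ (x2 _)
    have e : (1 : ℤ) + n = ((n + 1 : ℕ) : ℤ) := by push_cast; ring
    rw [e] at a4
    simpa [act_zero] using a4
  have stab : ∀ n, x n = x (n + 1) → ∀ m, x (n + m) = x n ∧ x (n + m) = x (n + m + 1) := by
    intro n hn m
    induction m with
    | zero => exact ⟨rfl, hn⟩
    | succ m ih => exact ⟨by rw [← add_assoc, ← ih.2, ih.1], stab1 _ ih.2⟩
  have xmono' : ∀ n m, leL Γ.P (x n) (x (n + m)) := by
    intro n m
    induction m with
    | zero => exact Γ.leL_refl' _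
    | succ m ih => exact Γ.leL_trans' ih (xmono _)
  obtain ⟨M, hM1, hM2⟩ := Γ.exists_large g 1 r hr (1 - Γ.zinf h - Γ.zinf h⁻¹)
  have hM : leL Γ.P (h * Γ.Δ ^ (1 : ℤ)) (Γ.act g r M h) := by
    have a2 := Γ.zinf_mul h⁻¹ (g ^ M)
    have a3 := Γ.zinf_mul (h⁻¹ * g ^ M) h
    have a4 : M * r + 1 ≤ Γ.zinf (h⁻¹ * g ^ M * h) := by omega
    rw [le_zinf_iff] at a4
    have a5 := Γ.leL_mul_right (-(M * r)) (Γ.leL_mul_left h a4)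
    have e : h * Γ.Δ ^ ((M : ℤ) * r + 1) * Γ.Δ ^ (-((M : ℤ) * r)) = h * Γ.Δ ^ (1 : ℤ) := by
      rw [mul_assoc, ← zpow_add]; congr 2; ring
    rw [e] at a5
    simpa [act, mul_assoc] using a5
  have hxM : leL Γ.P (h * Γ.Δ ^ (1 : ℤ)) (x M) := x3 _ _ hM (Γ.leL_refl' _)
  have main : ∀ n, x n = h * Γ.Δ ^ (1 : ℤ) ∨ n ≤ Γ.norm (h⁻¹ * x n) := by
    intro n
    induction n with
    | zero => right; omega
    | succ n ih =>
      by_cases hc : x n = x (n + 1)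
      · left
        obtain ⟨b1, -⟩ := stab n hc M
        have b2 := xmono' M n
        rw [add_comm M n, b1, hc] at b2
        exact Γ.leL_antisymm' (x2 _) (Γ.leL_trans' hxM b2)
      · rcases ih with ih | ih
        · exfalso
          apply hc
          apply Γ.leL_antisymm' (xmono _)
          rw [ih]; exact x2 _
        · right
          have c1 := Γ.norm_add_le (hxn n) (xmono n)
          have e : h⁻¹ * x n * ((x n)⁻¹ * x (n + 1)) = h⁻¹ * x (n + 1) := by group
          rw [e] at c1
          have c2 : Γ.norm ((x n)⁻¹ * x (n + 1)) ≠ 0 := by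
            intro h0
            exact hc (inv_mul_eq_one.1 (Γ.eq_one_of_norm (xmono n) h0))
          omega
  set N := Γ.norm Γ.Δ with hN
  have hNpos : 1 ≤ N := Γ.norm_Δ_pos
  have hxN : x N = h * Γ.Δ ^ (1 : ℤ) := by
    rcases main N with h1 | h1
    · exact h1
    · have c1 := Γ.norm_add_le (hxn N) (x2 N)
      have e : h⁻¹ * x N * ((x N)⁻¹ * (h * Γ.Δ ^ (1 : ℤ))) = Γ.Δ := by group
      rw [e] at c1
      exact inv_mul_eq_one.1 (Γ.eq_one_of_norm (x2 N) (by omega))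
  have fN : leL Γ.P (h * Γ.Δ ^ (1 : ℤ)) (Γ.act g r N h) := by
    rw [← hxN]; exact x1 N
  have fNn : ∀ n : ℕ, leL Γ.P (h * Γ.Δ ^ (n : ℤ)) (Γ.act g r (n * N) h) := by
    intro n
    induction n with
    | zero => simpa [act_zero] using Γ.leL_refl' h
    | succ n ih =>
      have d1 := Γ.act_mono g r N ih
      rw [act_act, act_Δ] at d1
      have d2 := Γ.leL_mul_right (n : ℤ) fN
      have d3 := Γ.leL_trans' d2 d1
      rw [mul_assoc, ← zpow_add] at d3
      have e1 : (1 : ℤ) + n = ((n + 1 : ℕ) : ℤ) := by push_cast; ring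
      have e2 : (N : ℤ) + n * N = ((n + 1 : ℕ) : ℤ) * N := by push_cast; ring
      rwa [e1, e2] at d3
  have fin := Γ.tinf_ge g h N hNpos (N * r + 1) (by
    intro n
    have d1 := Γ.leL_mul_right (n * N * r) (Γ.leL_mul_left h⁻¹ (fNn n))
    have e1 : h⁻¹ * (h * Γ.Δ ^ (n : ℤ)) * Γ.Δ ^ ((n : ℤ) * N * r)
        = Γ.Δ ^ ((n : ℤ) * (N * r + 1)) := by
      rw [inv_mul_cancel_left, ← zpow_add]; congr 1; ring
    have e2 : h⁻¹ * (Γ.act g r (n * N) h) * Γ.Δ ^ ((n : ℤ) * N * r)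
        = h⁻¹ * (g ^ N) ^ n * h := by
      unfold act
      have e3 : g ^ ((n : ℤ) * N) = (g ^ N) ^ n := by
        rw [← pow_mul, ← zpow_natCast]; congr 1; push_cast; ring
      rw [e3]
      simp [mul_assoc]
    rwa [e1, e2] at d1)
  have hN' : (0 : ℝ) < N := by exact_mod_cast hNpos
  push_cast at fin
  have : (r : ℝ) + 1 / N = (N * r + 1) / N := by field_simp
  rw [this, div_le_iff₀ hN']
  linarith

theorem rational_of_gap (T : ℝ) (N : ℕ) (hN : 1 ≤ N)
    (H : ∀ k : ℕ, 1 ≤ k → ∀ r : ℤ, (r : ℝ) < k * T → (r : ℝ) + 1 / (N : ℝ) ≤ k * T) :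
    ∃ p q : ℤ, 1 ≤ q ∧ q ≤ N ∧ T = p / q := by
  have hN' : (0 : ℝ) < N := by exact_mod_cast hN
  obtain ⟨j, k, hk0, hkN, hjk⟩ := Real.exists_int_int_abs_mul_sub_le T hN
  have hlt : (1 : ℝ) / (N + 1) < 1 / N := one_div_lt_one_div_of_lt hN' (by linarith)
  have hle : (1 : ℝ) / N ≤ 1 := by
    rw [div_le_one hN']; exact_mod_cast hN
  lift k to ℕ using hk0.le
  have hk1 : 1 ≤ k := by omega
  have hk' : (0 : ℝ) < k := by exact_mod_cast hk1
  rw [Int.cast_natCast] at hjk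
  rw [abs_le] at hjk
  refine ⟨j, k, by omega, hkN, ?_⟩
  rw [Int.cast_natCast, eq_div_iff hk'.ne', mul_comm]
  by_contra hne
  rcases lt_or_gt_of_ne hne with hc | hc
  · set ε : ℝ := j - k * T with hε
    have he0 : 0 < ε := by linarith
    have he1 : ε < 1 / N := by linarith
    have he2 : ε < 1 := by linarith
    -- the largest `m` with `m ε < 1`
    have h1 : 1 < ⌈1 / ε⌉₊ := by
      rw [Nat.lt_ceil, Nat.cast_one]
      exact (one_lt_div he0).2 he2
    obtain ⟨m, hm⟩ : ∃ m, ⌈1 / ε⌉₊ = m + 1 := ⟨⌈1 / ε⌉₊ - 1, by omega⟩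
    have hm1 : (m : ℝ) * ε < 1 := by
      have : m < ⌈1 / ε⌉₊ := by omega
      rw [Nat.lt_ceil, lt_div_iff₀ he0] at this
      exact this
    have hm2 : 1 ≤ ((m : ℝ) + 1) * ε := by
      have := Nat.le_ceil (1 / ε)
      rw [hm, div_le_iff₀ he0] at this
      exact_mod_cast this
    have hm0 : 1 ≤ m := by omega
    have e : ((m * k : ℕ) : ℝ) * T = m * j - m * ε := by
      rw [hε]; push_cast; ring
    have := H (m * k) (Nat.mul_pos hm0 hk1) (m * j - 1) (by
      rw [e]; push_cast; linarith)
    rw [e] at this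
    push_cast at this
    linarith
  · have := H k hk1 j hc
    linarith

theorem tinf_rational (g : G) :
    ∃ p q : ℤ, 1 ≤ q ∧ q ≤ (Γ.norm Γ.Δ : ℤ) ∧ Γ.tinf g = p / q := by
  apply rational_of_gap _ _ Γ.norm_Δ_pos
  intro k hk r hr
  rw [← Γ.tinf_pow g k hk] at hr ⊢
  exact Γ.gap _ r hr

end trans

end GarsideGroup

/-- For every `g` in a Garside group `G`, the limit defining the translation
number `t_𝒟(g)` (w.r.t. `𝒟 ∪ 𝒟⁻¹`) exists and equals `p/q` for some integers `p, q`
with `1 ≤ q ≤ N²`, where `N = ‖Δ‖`. -/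
theorem statement0 {G : Type*} [Group G] (Γ : GarsideGroup G) (g : G) :
    ∃ p q : ℤ, 1 ≤ q ∧ q ≤ (Γ.norm Γ.Δ : ℤ) ^ 2 ∧
      Filter.Tendsto
        (fun n : ℕ => (wlen (Γ.simples ∪ Γ.simples⁻¹) (g ^ n) : ℝ) / (n : ℝ))
        Filter.atTop (nhds ((p : ℝ) / (q : ℝ))) := by
  obtain ⟨a, b, hb1, hb2, hab⟩ := Γ.tinf_rational g
  obtain ⟨c, d, hd1, hd2, hcd⟩ := Γ.tinf_rational g⁻¹
  have hb' : (0 : ℝ) < b := by exact_mod_cast hb1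
  have hd' : (0 : ℝ) < d := by exact_mod_cast hd1
  refine ⟨max (-c) 0 * b + max (-a) 0 * d, b * d, by nlinarith, by nlinarith, ?_⟩
  have h1 := ((Γ.tsup_spec g).max (tendsto_const_nhds (x := (0 : ℝ)))).add
    ((Γ.tinf_spec g).neg.max (tendsto_const_nhds (x := (0 : ℝ))))
  have e : max (Γ.tsup g) 0 + max (-Γ.tinf g) 0
      = ((max (-c) 0 * b + max (-a) 0 * d : ℤ) : ℝ) / ((b * d : ℤ) : ℝ) := by
    rw [Γ.tsup_eq, hab, hcd]
    have e1 : max (-((c : ℝ) / d)) 0 = max (-(c : ℝ)) 0 / d := by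
      rw [← neg_div, ← max_div_div_right hd'.le, zero_div]
    have e2 : max (-((a : ℝ) / b)) 0 = max (-(a : ℝ)) 0 / b := by
      rw [← neg_div, ← max_div_div_right hb'.le, zero_div]
    rw [e1, e2]
    push_cast
    field_simp
  rw [e] at h1
  refine h1.congr fun n => ?_
  have hn : (0 : ℝ) ≤ n := Nat.cast_nonneg n
  have hw := Γ.wlen_eq (g ^ n)
  have hw' : (wlen (Γ.simples ∪ Γ.simples⁻¹) (g ^ n) : ℝ)
      = max (Γ.zsup (g ^ n) : ℝ) 0 + max (-(Γ.zinf (g ^ n) : ℝ)) 0 := by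
    exact_mod_cast hw
  rw [hw', add_div, ← max_div_div_right hn, ← max_div_div_right hn, zero_div, neg_div]
end

section
/- Let G be a Garside group with Garside element Δ and N = ‖Δ‖. For every element g of G, both t_inf(g) and t_sup(g) are rational numbers of the form p/q for some integers p, q with 1 ≤ q ≤ N. -/
open Filter Topology Pointwise

namespace GarsideAux

lemma number_lemma (t : ℝ) (N : ℕ) (hN : 1 ≤ N)
    (H : ∀ n : ℕ, 1 ≤ n → ∀ r : ℤ, (r : ℝ) < n * t → (r : ℝ) * N + 1 ≤ n * N * t) :
    ∃ p q : ℤ, 1 ≤ q ∧ q ≤ (N : ℤ) ∧ t = (p : ℝ) / (q : ℝ) := by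
  obtain ⟨j, k, hk0, hkN, hjk⟩ := Real.exists_int_int_abs_mul_sub_le t (n := N) (by omega)
  refine ⟨j, k, by omega, hkN, ?_⟩
  have hkR : (0 : ℝ) < k := by exact_mod_cast hk0
  have hNR : (1 : ℝ) ≤ N := by exact_mod_cast hN
  rw [eq_div_iff hkR.ne']
  have hlt : (1 : ℝ) / (N + 1) * N < 1 := by
    rw [div_mul_eq_mul_div, div_lt_one (by linarith)]; linarith
  obtain ⟨h1, h2⟩ := abs_le.mp hjk
  obtain ⟨k', rfl⟩ : ∃ k' : ℕ, k = (k' : ℤ) := ⟨k.toNat, by omega⟩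
  have hk' : 1 ≤ k' := by omega
  simp only [Int.cast_natCast] at *
  rcases lt_trichotomy ((k' : ℝ) * t) (j : ℝ) with h | h | h
  · exfalso
    set ε : ℝ := j - k' * t with hε
    have hε0 : 0 < ε := by linarith
    have hε1 : ε * N < 1 := by
      have : ε * N ≤ 1 / (N + 1) * N := by
        apply mul_le_mul_of_nonneg_right _ (by linarith); linarith
      linarith
    have hεlt : ε < 1 := by nlinarith
    set c := ⌈1 / ε⌉₊ with hc
    have hc1 : 1 / ε ≤ c := Nat.le_ceil _
    have hc2 : (c : ℝ) < 1 / ε + 1 := Nat.ceil_lt_add_one (by positivity)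
    have hone : 1 < 1 / ε := by rw [lt_div_iff₀ hε0]; linarith
    have hc3 : 2 ≤ c := by
      have : (1 : ℝ) < c := by linarith
      exact_mod_cast this
    obtain ⟨m, hm⟩ : ∃ m, c = m + 1 := ⟨c - 1, by omega⟩
    have hm1 : 1 ≤ m := by omega
    rw [hm] at hc1 hc2
    push_cast at hc1 hc2
    have e1 : 1 ≤ (m + 1) * ε := by rwa [div_le_iff₀ hε0] at hc1
    have e2 : m * ε < 1 := by
      have : (m : ℝ) < 1 / ε := by linarith
      rwa [lt_div_iff₀ hε0] at this
    have hh := H (m * k') (Nat.mul_pos hm1 hk') (m * j - 1) (by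
      push_cast
      have : (m : ℝ) * k' * t = m * j - m * ε := by rw [hε]; ring
      linarith)
    push_cast at hh
    have e3 : (m : ℝ) * k' * N * t = (m * j - m * ε) * N := by rw [hε]; ring
    rw [e3] at hh
    have e4 : (m * ε) * N + 1 ≤ N := by linarith
    have e5 : (N : ℝ) ≤ (m * ε + ε) * N := by nlinarith
    nlinarith
  · linarith
  · exfalso
    have := H k' hk' j h
    have h3 : (k' * t - j) * N ≤ 1 / (N + 1) * N := by
      apply mul_le_mul_of_nonneg_right _ (by linarith); linarith
    linarith

section Lattice

variable {L : Type*} [SemilatticeInf L]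

lemma zpow_mono (φ : L ≃o L) (hφ : ∀ x, x ≤ φ x) (x : L) {a b : ℤ} (h : a ≤ b) :
    (φ ^ a) x ≤ (φ ^ b) x := by
  induction b, h using Int.leInduction with
  | base => exact le_rfl
  | succ b hb ih =>
    refine ih.trans ?_
    rw [add_comm, zpow_add, zpow_one]
    exact hφ _

lemma pow_iter_le (f : L ≃o L) (x : L) (h : x ≤ f x) (n : ℕ) : x ≤ (f ^ n) x := by
  induction n with
  | zero => exact le_rfl
  | succ n ih =>
    rw [pow_succ']
    exact h.trans (f.monotone ih)

/-- From `e ≤ h^m e` build a point `y` with `y ≤ h y`. -/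
lemma exists_fix (h : L ≃o L) (e : L) (m : ℕ) (hm : 1 ≤ m) (he : e ≤ (h ^ m) e) :
    ∃ y, y ≤ h y := by
  have key : ∀ k : ℕ, ∃ y, y ≤ e ∧ y ⊓ (h ^ (k + 1)) e ≤ h y := by
    intro k
    induction k with
    | zero => exact ⟨e, le_rfl, by simp⟩
    | succ k ih =>
      obtain ⟨y, hy, hy2⟩ := ih
      refine ⟨e ⊓ h y, inf_le_left, ?_⟩
      rw [OrderIso.map_inf]
      refine le_inf ?_ ?_
      · exact inf_le_left.trans (inf_le_right.trans (h.monotone hy))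
      · have h1 : h (y ⊓ (h ^ (k + 1)) e) ≤ h (h y) := h.monotone hy2
        refine le_trans ?_ h1
        rw [OrderIso.map_inf, pow_succ' h (k + 1)]
        exact inf_le_inf_right _ inf_le_right
  obtain ⟨k, rfl⟩ : ∃ k, m = k + 1 := ⟨m - 1, by omega⟩
  obtain ⟨y, hy, hy2⟩ := key k
  exact ⟨y, (le_inf le_rfl (hy.trans he)).trans hy2⟩

lemma stab (φ h : L ≃o L) (hφ : ∀ x, x ≤ φ x) (hc : φ * h = h * φ) (N : ℕ)
    (chain : ∀ (x : L) (f : ℕ → L), x ≤ f 0 → (∀ k, f k ≤ φ x) → (∀ k < N, f k < f (k + 1)) →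
      f N = φ x)
    (y : L) (hy : y ≤ h y) (m : ℕ) (hm : φ y ≤ (h ^ m) y) : φ y ≤ (h ^ N) y := by
  have hmono1 : ∀ k, (h ^ k) y ≤ (h ^ (k + 1)) y := fun k => by
    rw [pow_succ]; exact (h ^ k).monotone hy
  have hmono : Monotone fun k => (h ^ k) y := monotone_nat_of_le_succ hmono1
  have hφh : φ y ≤ h (φ y) := by
    have : φ (h y) = h (φ y) := congrArg (fun f : L ≃o L => f y) hc
    rw [← this]; exact φ.monotone hy
  set f : ℕ → L := fun k => (h ^ k) y ⊓ φ y with hf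
  have hfm : Monotone f := fun a b hab => inf_le_inf_right _ (hmono hab)
  have step : ∀ k, f (k + 1) = h (f k) ⊓ φ y := by
    intro k
    simp only [hf, OrderIso.map_inf]
    rw [pow_succ', inf_assoc, inf_eq_right.mpr hφh]; rfl
  by_cases hs : ∀ k < N, f k < f (k + 1)
  · have := chain y f (by simp [hf, hφ]) (fun k => inf_le_right) hs
    exact inf_eq_right.mp this
  · push Not at hs
    obtain ⟨k, hk, hk2⟩ := hs
    have e0 : f k = f (k + 1) := by
      by_contra hne
      exact hk2 (lt_of_le_of_ne (hfm (by omega)) hne)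
    have e1 : ∀ j, f (k + j) = f k := by
      intro j
      induction j with
      | zero => rfl
      | succ j ih => rw [← add_assoc, step, ih, ← step, e0]
    have e2 : f (k + m) = φ y := inf_eq_right.mpr (hm.trans (hmono (by omega)))
    have e3 : f N = φ y := by
      rw [show N = k + (N - k) by omega, e1, ← e1 m, e2]
    exact inf_eq_right.mp e3

lemma main_lattice (φ g : L ≃o L) (hφ : ∀ x, x ≤ φ x) (hc : Commute φ g) (N : ℕ) (hN : 1 ≤ N)
    (cof : ∀ x y : L, ∃ a : ℤ, x ≤ (φ ^ a) y)
    (chain : ∀ (x : L) (f : ℕ → L), x ≤ f 0 → (∀ k, f k ≤ φ x) → (∀ k < N, f k < f (k + 1)) →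
      f N = φ x)
    (e : L) (I : ℕ → ℤ) (hI : ∀ n, IsGreatest {r : ℤ | (φ ^ r) e ≤ (g ^ n) e} (I n))
    (t : ℝ) (ht : Tendsto (fun n : ℕ => (I n : ℝ) / (n : ℝ)) atTop (nhds t)) :
    ∃ p q : ℤ, 1 ≤ q ∧ q ≤ (N : ℤ) ∧ t = (p : ℝ) / (q : ℝ) := by
  apply number_lemma t N hN
  intro n hn r hr
  have hnR : (0 : ℝ) < n := by exact_mod_cast hn
  set h : L ≃o L := φ ^ (-r) * g ^ n with hh
  have hcz : ∀ (a : ℤ) (m : ℕ), Commute (φ ^ a) (g ^ m) :=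
    fun a m => (hc.zpow_left a).pow_right m
  have hch : Commute φ h := (Commute.refl φ).zpow_right (-r) |>.mul_right (hc.pow_right n)
  have hpow : ∀ m : ℕ, h ^ m = φ ^ (-(r * m)) * g ^ (n * m) := by
    intro m
    rw [hh, (hcz _ _).mul_pow, ← zpow_natCast, ← zpow_mul, ← pow_mul]
    congr 2; ring
  have iter : ∀ C : ℤ, ∃ m : ℕ, 1 ≤ m ∧ (φ ^ C) e ≤ (h ^ m) e := by
    intro C
    have h1 : Tendsto (fun m : ℕ => (I (n * m) : ℝ) / ((n * m : ℕ) : ℝ)) atTop (nhds t) :=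
      ht.comp (tendsto_id.const_mul_atTop' (by omega : 0 < n))
    have h2 : Tendsto (fun m : ℕ => (r : ℝ) / n + (C : ℝ) / n / m) atTop (nhds ((r : ℝ) / n + 0)) :=
      tendsto_const_nhds.add (tendsto_const_div_atTop_nhds_zero_nat _)
    have h3 : (r : ℝ) / n + 0 < t := by
      rw [add_zero, div_lt_iff₀ hnR]; linarith
    obtain ⟨m, hm, hm1⟩ := ((h2.eventually_lt h1 h3).and (eventually_ge_atTop 1)).exists
    refine ⟨m, hm1, ?_⟩
    have hmR : (0 : ℝ) < m := by exact_mod_cast hm1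
    have h4 : (r : ℝ) * m + C < I (n * m) := by
      rw [lt_div_iff₀ (by push_cast; positivity)] at hm
      push_cast at hm
      have : ((r : ℝ) / n + (C : ℝ) / n / m) * (n * m) = r * m + C := by field_simp
      linarith
    have h5 : r * m + C ≤ I (n * m) := by exact_mod_cast h4.le
    have h6 := (zpow_mono φ hφ e h5).trans (hI (n * m)).1
    rw [hpow]
    have h7 := (φ ^ (-(r * m))).monotone h6
    have h8 : φ ^ C = φ ^ (-(r * m)) * φ ^ (r * m + C) := by
      rw [← zpow_add]; congr 1; ring
    rw [h8]
    exact h7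
  obtain ⟨m0, hm0, hm0'⟩ := iter 0
  obtain ⟨y, hy⟩ := exists_fix h e m0 hm0 (by simpa using hm0')
  obtain ⟨a, ha⟩ := cof y e
  obtain ⟨b, hb⟩ := cof e y
  have hb' : (φ ^ (-b)) e ≤ y := by
    have := (φ ^ (-b)).monotone hb
    rwa [← RelIso.mul_apply, ← zpow_add, neg_add_cancel, zpow_zero] at this
  obtain ⟨m, hm, hm'⟩ := iter (b + 1 + a)
  have hmy : φ y ≤ (h ^ m) y := by
    have c1 : (h ^ m) ((φ ^ (-b)) e) ≤ (h ^ m) y := (h ^ m).monotone hb'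
    have c2 : (h ^ m) ((φ ^ (-b)) e) = (φ ^ (-b)) ((h ^ m) e) := by
      rw [← RelIso.mul_apply, ← RelIso.mul_apply, ((hch.zpow_left (-b)).pow_right m).eq]
    have c3 := (φ ^ (-b)).monotone hm'
    have c4 : (φ ^ (-b)) ((φ ^ (b + 1 + a)) e) = φ ((φ ^ a) e) := by
      rw [← RelIso.mul_apply, ← zpow_add, ← RelIso.mul_apply, ← zpow_one_add]
      congr 2; ring
    have c5 := φ.monotone ha
    calc φ y ≤ φ ((φ ^ a) e) := c5
      _ = (φ ^ (-b)) ((φ ^ (b + 1 + a)) e) := c4.symm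
      _ ≤ _ := c3
      _ = _ := c2.symm
      _ ≤ _ := c1
  have hNy := stab φ h hφ hch.eq N chain y hy m hmy
  -- iterate
  have hk : ∀ k : ℕ, (r * N + 1) * k - b - a ≤ I (n * N * k) := by
    intro k
    apply (hI _).2
    change (φ ^ ((r * N + 1) * k - b - a)) e ≤ (g ^ (n * N * k)) e
    have d0 : y ≤ (φ ^ (-1 : ℤ) * h ^ N) y := by
      have := (φ ^ (-1 : ℤ)).monotone hNy
      rwa [← RelIso.mul_apply, ← zpow_add_one, neg_add_cancel, zpow_zero] at this
    have d1 := pow_iter_le _ y d0 k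
    have d2 : (φ ^ (-1 : ℤ) * h ^ N) ^ k = φ ^ (-((r * N + 1) * k)) * g ^ (n * N * k) := by
      rw [hpow, ← mul_assoc, ← zpow_add, (hcz _ _).mul_pow, ← zpow_natCast, ← zpow_mul, ← pow_mul]
      congr 2; ring
    rw [d2] at d1
    have d3 := hb'.trans (d1.trans ((φ ^ (-((r * N + 1) * k)) * g ^ (n * N * k)).monotone ha))
    have d4 := (φ ^ ((r * N + 1) * k - a)).monotone d3
    have d5 : (φ ^ ((r * N + 1) * k - a)) ((φ ^ (-b)) e) = (φ ^ ((r * N + 1) * k - b - a)) e := by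
      rw [← RelIso.mul_apply, ← zpow_add]; congr 2; ring
    have d6 : (φ ^ ((r * N + 1) * k - a))
        ((φ ^ (-((r * N + 1) * k)) * g ^ (n * N * k)) ((φ ^ a) e)) = (g ^ (n * N * k)) e := by
      rw [← RelIso.mul_apply, ← RelIso.mul_apply, ← mul_assoc, ← zpow_add, mul_assoc,
        ← (hcz a _).eq, ← mul_assoc, ← zpow_add]
      rw [show (r * N + 1) * k - a + -((r * N + 1) * k) + a = (0 : ℤ) by ring, zpow_zero, one_mul]
    rwa [d5, d6] at d4
  have hNR : (0 : ℝ) < N := by exact_mod_cast hN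
  have l1 : Tendsto (fun k : ℕ => (I (n * N * k) : ℝ) / ((n * N * k : ℕ) : ℝ)) atTop (nhds t) :=
    ht.comp (tendsto_id.const_mul_atTop' (by positivity : 0 < n * N))
  have l2 : Tendsto (fun k : ℕ => ((r : ℝ) * N + 1) / (n * N) - ((b : ℝ) + a) / (n * N) / k) atTop
      (nhds (((r : ℝ) * N + 1) / (n * N) - 0)) :=
    tendsto_const_nhds.sub (tendsto_const_div_atTop_nhds_zero_nat _)
  have l3 := le_of_tendsto_of_tendsto l2 l1 (by
    filter_upwards [eventually_ge_atTop 1] with k hk1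
    have hkR : (0 : ℝ) < k := by exact_mod_cast hk1
    rw [le_div_iff₀ (by push_cast; positivity)]
    have : (((r * N + 1) * k - b - a : ℤ) : ℝ) ≤ I (n * N * k) := by exact_mod_cast hk k
    refine le_trans (le_of_eq ?_) this
    push_cast
    field_simp
    ring)
  rw [sub_zero, div_le_iff₀ (by positivity)] at l3
  linarith

end Lattice

section Gar

variable {G : Type*} [Group G] (Γ : GarsideGroup G)

lemma atom_prod_mul {P : Submonoid G} {m n : ℕ} {a b : G} (ha : IsAtomProd P m a)
    (hb : IsAtomProd P n b) : IsAtomProd P (m + n) (a * b) := by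
  obtain ⟨l, h1, h2, h3⟩ := ha
  obtain ⟨l', h1', h2', h3'⟩ := hb
  refine ⟨l ++ l', by simp [h1, h1'], ?_, by simp [h3, h3']⟩
  intro x hx
  rcases List.mem_append.mp hx with h | h
  · exact h2 x h
  · exact h2' x h

lemma norm_mul {a b : G} (ha : a ∈ Γ.P) (hb : b ∈ Γ.P) :
    Γ.norm a + Γ.norm b ≤ Γ.norm (a * b) :=
  (Γ.norm_spec _ (Γ.P.mul_mem ha hb)).2
    (atom_prod_mul (Γ.norm_spec a ha).1 (Γ.norm_spec b hb).1)

lemma norm_pos {a : G} (ha : a ∈ Γ.P) (h1 : a ≠ 1) : 1 ≤ Γ.norm a := by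
  by_contra h
  obtain ⟨l, hl, -, h3⟩ := (Γ.norm_spec a ha).1
  have : l = [] := List.length_eq_zero_iff.mp (by omega)
  subst this
  exact h1 (by simpa using h3.symm)

lemma conical {a : G} (ha : a ∈ Γ.P) (hb : a⁻¹ ∈ Γ.P) : a = 1 := by
  by_contra h
  have h1 := norm_mul Γ ha hb
  have h2 := norm_pos Γ ha h
  have h3 := norm_mul Γ Γ.P.one_mem Γ.P.one_mem
  rw [mul_inv_cancel] at h1
  rw [mul_one] at h3
  omega

lemma conj_mem {a : G} (ha : a ∈ Γ.P) : Γ.Δ⁻¹ * a * Γ.Δ ∈ Γ.P := by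
  have hle : Γ.P ≤ Γ.P.comap (MulAut.conj Γ.Δ⁻¹).toMonoidHom := by
    conv_lhs => rw [← Γ.simples_gen]
    rw [Submonoid.closure_le]
    rintro s ⟨hs, hsΔ⟩
    have hu : leL Γ.P (s⁻¹ * Γ.Δ) Γ.Δ := by
      rw [Γ.Δ_balanced _ hsΔ]
      simpa [leR] using hs
    simpa [leL, mul_assoc] using hu
  simpa using hle ha

lemma conj_mem' {a : G} (ha : a ∈ Γ.P) : Γ.Δ * a * Γ.Δ⁻¹ ∈ Γ.P := by
  have hle : Γ.P ≤ Γ.P.comap (MulAut.conj Γ.Δ).toMonoidHom := by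
    conv_lhs => rw [← Γ.simples_gen]
    rw [Submonoid.closure_le]
    rintro s ⟨hs, hsΔ⟩
    have hsR : leR Γ.P s Γ.Δ := (Γ.Δ_balanced _ hs).mp hsΔ
    have hu : leR Γ.P (Γ.Δ * s⁻¹) Γ.Δ := by
      rw [← Γ.Δ_balanced _ hsR]
      simpa [leL] using hs
    simpa [leR, mul_assoc] using hu
  simpa using hle ha

lemma conj_mem_iff (a : G) : Γ.Δ⁻¹ * a * Γ.Δ ∈ Γ.P ↔ a ∈ Γ.P :=
  ⟨fun h => by simpa [mul_assoc] using conj_mem' Γ h, conj_mem Γ⟩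

lemma exists_pos (x y : G) : ∃ c ∈ Γ.P, c * x ∈ Γ.P ∧ c * y ∈ Γ.P := by
  obtain ⟨a, b, ha, hb, rfl⟩ := Γ.fraction x
  obtain ⟨a', b', ha', hb', h⟩ := Γ.fraction (a * y)
  refine ⟨a' * a, Γ.P.mul_mem ha' ha, ?_, ?_⟩
  · simpa [mul_assoc] using Γ.P.mul_mem ha' hb
  · rw [mul_assoc, h]; simpa using hb'

lemma leL_trans {P : Submonoid G} {a b c : G} (h : leL P a b) (h' : leL P b c) : leL P a c := by
  have := P.mul_mem h h'
  simpa [leL, mul_assoc] using this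

lemma leL_mul {P : Submonoid G} (c : G) {a b : G} : leL P (c * a) (c * b) ↔ leL P a b := by
  simp [leL, mul_assoc]

lemma meet_pos {x y : G} (hx : x ∈ Γ.P) (hy : y ∈ Γ.P) :
    ∃ m, leL Γ.P m x ∧ leL Γ.P m y ∧ ∀ d, leL Γ.P d x → leL Γ.P d y → leL Γ.P d m := by
  obtain ⟨m, hm, h1, h2, h3⟩ := (Γ.latticeL x hx y hy).1
  refine ⟨m, h1, h2, fun d hdx hdy => ?_⟩
  obtain ⟨c, hc, hcd, -⟩ := exists_pos Γ d 1
  obtain ⟨e, he, e1, e2, e3⟩ :=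
    (Γ.latticeL (c * x) (Γ.P.mul_mem hc hx) (c * y) (Γ.P.mul_mem hc hy)).1
  have f1 : leL Γ.P (c * d) e := e3 _ hcd ((leL_mul c).mpr hdx) ((leL_mul c).mpr hdy)
  have f2 : leL Γ.P c e := e3 _ hc (by simpa [leL] using hx) (by simpa [leL] using hy)
  have f3 : leL Γ.P (c⁻¹ * e) m := by
    refine h3 _ f2 ?_ ?_
    · rw [← leL_mul c]; simpa using e1
    · rw [← leL_mul c]; simpa using e2
  refine leL_trans ?_ f3
  rw [← leL_mul c]; simpa using f1

lemma meet_all (x y : G) :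
    ∃ m, leL Γ.P m x ∧ leL Γ.P m y ∧ ∀ d, leL Γ.P d x → leL Γ.P d y → leL Γ.P d m := by
  obtain ⟨c, hc, hx, hy⟩ := exists_pos Γ x y
  obtain ⟨m, h1, h2, h3⟩ := meet_pos Γ hx hy
  refine ⟨c⁻¹ * m, ?_, ?_, fun d hdx hdy => ?_⟩
  · rw [← leL_mul c]; simpa using h1
  · rw [← leL_mul c]; simpa using h2
  · rw [← leL_mul c]; simpa using h3 _ ((leL_mul c).mpr hdx) ((leL_mul c).mpr hdy)

/-- The lattice order on `G`. -/
@[reducible] noncomputable def lat : SemilatticeInf G where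
  le := leL Γ.P
  le_refl a := by simp [leL, Γ.P.one_mem]
  le_trans a b c h h' := leL_trans h h'
  le_antisymm a b h h' := by
    have := conical Γ h (by simpa [leL] using h')
    exact inv_mul_eq_one.mp this
  inf x y := (meet_all Γ x y).choose
  inf_le_left x y := (meet_all Γ x y).choose_spec.1
  inf_le_right x y := (meet_all Γ x y).choose_spec.2.1
  le_inf d x y h h' := (meet_all Γ x y).choose_spec.2.2 d h h'

lemma tinf_rat (g : G) (t : ℝ)
    (ht : Tendsto (fun n : ℕ => (Γ.zinf (g ^ n) : ℝ) / (n : ℝ)) atTop (nhds t)) :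
    ∃ p q : ℤ, 1 ≤ q ∧ q ≤ (Γ.norm Γ.Δ : ℤ) ∧ t = (p : ℝ) / (q : ℝ) := by
  letI := lat Γ
  have le_def : ∀ a b : G, a ≤ b ↔ a⁻¹ * b ∈ Γ.P := fun a b => Iff.rfl
  have hΔ : Γ.Δ ≠ 1 := by
    intro h
    have h1 := (Γ.zinf_spec 1).2 (show Γ.zinf 1 + 1 ∈ _ by simp [h, leL, Γ.P.one_mem])
    omega
  let φ : G ≃o G := 
    { Equiv.mulRight Γ.Δ with
      map_rel_iff' := by
        intro a b
        change (a * Γ.Δ)⁻¹ * (b * Γ.Δ) ∈ Γ.P ↔ a⁻¹ * b ∈ Γ.P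
        rw [← conj_mem_iff Γ (a⁻¹ * b)]
        simp [mul_assoc] }
  let γ : G ≃o G := 
    { Equiv.mulLeft g with
      map_rel_iff' := by
        intro a b
        exact leL_mul g }
  have hφ1 : ∀ x, φ x = x * Γ.Δ := fun x => rfl
  have hγ1 : ∀ x, γ x = g * x := fun x => rfl
  have hφs : ∀ x, (φ⁻¹ : G ≃o G) x = x * Γ.Δ⁻¹ := fun x => rfl
  have hγ : ∀ (n : ℕ) x, (γ ^ n) x = g ^ n * x := by
    intro n
    induction n with
    | zero => intro x; simp
    | succ n ih => intro x; rw [pow_succ, RelIso.mul_apply, ih, hγ1, pow_succ, mul_assoc]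
  have hφ : ∀ (a : ℤ) x, (φ ^ a) x = x * Γ.Δ ^ a := by
    intro a
    induction a with
    | zero => intro x; simp
    | succ n ih =>
      intro x; rw [zpow_add_one, RelIso.mul_apply, ih, hφ1, add_comm, zpow_one_add, mul_assoc]
    | pred n ih =>
      intro x
      rw [zpow_sub_one, RelIso.mul_apply, ih, hφs, sub_eq_neg_add, zpow_add, zpow_neg_one,
        mul_assoc]
  refine main_lattice φ γ ?_ ?_ (Γ.norm Γ.Δ) (norm_pos Γ Γ.Δ_mem hΔ) ?_ ?_ 1
    (fun n => Γ.zinf (g ^ n)) ?_ t ht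
  · intro x
    rw [le_def, hφ1]; simpa using Γ.Δ_mem
  · ext x
    simp only [RelIso.mul_apply, hφ1, hγ1, mul_assoc]
  · intro x y
    refine ⟨Γ.zsup (y⁻¹ * x), ?_⟩
    have := (Γ.zsup_spec (y⁻¹ * x)).1
    rw [le_def, hφ]
    simpa [leL, mul_assoc] using this
  · intro x f h0 hf hs
    have hk : ∀ k ≤ Γ.norm Γ.Δ, x ≤ f k ∧ k ≤ Γ.norm (x⁻¹ * f k) := by
      intro k
      induction k with
      | zero => exact fun _ => ⟨h0, Nat.zero_le _⟩
      | succ k ih =>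
        intro hk
        obtain ⟨i1, i2⟩ := ih (by omega)
        have hlt := hs k (by omega)
        refine ⟨i1.trans hlt.le, ?_⟩
        have n1 := norm_pos Γ ((le_def _ _).mp hlt.le) (fun h => hlt.ne (inv_mul_eq_one.mp h))
        have n2 := norm_mul Γ ((le_def _ _).mp i1) ((le_def _ _).mp hlt.le)
        rw [show x⁻¹ * f k * ((f k)⁻¹ * f (k + 1)) = x⁻¹ * f (k + 1) by group] at n2
        omega
    obtain ⟨k1, k2⟩ := hk _ le_rfl
    by_contra hne
    have n1 := norm_pos Γ ((le_def _ _).mp (hf (Γ.norm Γ.Δ))) (fun h => hne (inv_mul_eq_one.mp h))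
    have n2 := norm_mul Γ ((le_def _ _).mp k1) ((le_def _ _).mp (hf (Γ.norm Γ.Δ)))
    rw [hφ1] at n1 n2
    rw [show x⁻¹ * f (Γ.norm Γ.Δ) * ((f (Γ.norm Γ.Δ))⁻¹ * (x * Γ.Δ)) = Γ.Δ by group] at n2
    omega
  · intro n
    have := Γ.zinf_spec (g ^ n)
    simp only [hφ, hγ, one_mul, mul_one]
    exact this

lemma conj_zpow_mem (s : ℤ) {a : G} (ha : a ∈ Γ.P) : Γ.Δ ^ s * a * (Γ.Δ ^ s)⁻¹ ∈ Γ.P := by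
  induction s with
  | zero => simpa using ha
  | succ n ih =>
    have := conj_mem' Γ ih
    simpa [add_comm (n : ℤ) 1, zpow_add, mul_assoc] using this
  | pred n ih =>
    have := conj_mem Γ ih
    rw [sub_eq_neg_add, zpow_add]
    simpa [mul_assoc] using this

lemma zsup_eq (g : G) : Γ.zsup g = -Γ.zinf g⁻¹ := by
  apply le_antisymm
  · apply (Γ.zsup_spec g).2
    have h := (Γ.zinf_spec g⁻¹).1
    have := conj_zpow_mem Γ (Γ.zinf g⁻¹) h
    simpa [leL, mul_assoc] using this
  · rw [neg_le]
    apply (Γ.zinf_spec g⁻¹).2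
    have h := (Γ.zsup_spec g).1
    have := conj_zpow_mem Γ (Γ.zsup g) h
    simpa [leL, mul_assoc] using this

end Gar
end GarsideAux

/-- For every `g`, both `t_inf(g)` and `t_sup(g)` are rational of the
form `p/q` with `1 ≤ q ≤ N`, where `N = ‖Δ‖`. -/
theorem statement2 {G : Type*} [Group G] (Γ : GarsideGroup G) (g : G) :
    (∃ p q : ℤ, 1 ≤ q ∧ q ≤ (Γ.norm Γ.Δ : ℤ) ∧ Γ.tinf g = (p : ℝ) / (q : ℝ)) ∧
    (∃ p q : ℤ, 1 ≤ q ∧ q ≤ (Γ.norm Γ.Δ : ℤ) ∧ Γ.tsup g = (p : ℝ) / (q : ℝ)) := by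
  refine ⟨GarsideAux.tinf_rat Γ g _ (Γ.tinf_spec g), ?_⟩
  obtain ⟨p, q, h1, h2, h3⟩ := GarsideAux.tinf_rat Γ g⁻¹ (-Γ.tsup g) (by
    have := (Γ.tsup_spec g).neg
    refine this.congr fun n => ?_
    rw [GarsideAux.zsup_eq, inv_pow]
    push_cast
    ring)
  refine ⟨-p, q, h1, h2, ?_⟩
  push_cast
  rw [neg_div, ← h3, neg_neg]
end
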